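/- arXiv:1506.08155 — 2 statements merged into one kernel-verified Lean document; each statement's English description precedes it below -/
import Mathlib

section
/- For every fixed a ∈ ℝ, the function σ ↦ G(−σ² + a, 2σ²) is strictly decreasing on (0, ∞); moreover its derivative with respect to σ is at most −√2 · φ( −σ/√2 + a/(σ√2) ) < 0 for every σ > 0, where φ is the standard normal density. -/
open MeasureTheory ProbabilityTheory Real Filter Set
open scoped Topology

/-- The Metropolis–Hastings accept-reject function `F(u) = min(1, eᵘ)`. -/
noncomputable def Facc (u : ℝ) : ℝ := min 1 (Real.exp u)

/-- The law of the limiting bivariate Gaussian pair `(Q∞, S∞)` with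
`Q∞ ~ N(−μ²/2, μ²)`, `S∞ ~ N(β₁μ²/2, β₂²μ²)` and `Cov(Q∞, S∞) = −β₁μ²`
(valid whenever `|β₁| ≤ β₂`), realised as the image of two independent
standard Gaussians. -/
noncomputable def QSmeas (μ β₁ β₂ : ℝ) : Measure (ℝ × ℝ) :=
  Measure.map
    (fun z : ℝ × ℝ =>
      (-μ ^ 2 / 2 + μ * z.1,
        β₁ * μ ^ 2 / 2 + μ * (-(β₁ * z.1) + Real.sqrt (β₂ ^ 2 - β₁ ^ 2) * z.2)))
    ((gaussianReal 0 1).prod (gaussianReal 0 1))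

/-- Law of `W_Δ = W* − W ~ N(−σ², 2σ²)` under the Gaussian noise assumption. -/
noncomputable def gaussNoise (σ : ℝ) : Measure ℝ :=
  gaussianReal (-σ ^ 2) (Real.toNNReal (2 * σ ^ 2))

/-- Limiting Stage One acceptance rate `α₁(μ; β₁, β₂) = E[F(Q∞ + S∞)]`. -/
noncomputable def alpha1 (μ β₁ β₂ : ℝ) : ℝ :=
  ∫ p : ℝ × ℝ, Facc (p.1 + p.2) ∂(QSmeas μ β₁ β₂)

/-- Limiting overall acceptance rate `α₁₂(μ, σ; β₁, β₂) = E[F(Q∞ + S∞)·F(W_Δ − S∞)]`. -/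
noncomputable def alpha12 (μ σ β₁ β₂ : ℝ) : ℝ :=
  ∫ p : (ℝ × ℝ) × ℝ, Facc (p.1.1 + p.1.2) * Facc (p.2 - p.1.2)
    ∂((QSmeas μ β₁ β₂).prod (gaussNoise σ))

/-- Standard normal cumulative distribution function `Φ`. -/
noncomputable def stdPhi (x : ℝ) : ℝ := ((gaussianReal 0 1) (Set.Iic x)).toReal

/-- `G(m, v) = E[min(1, e^N)]` for `N ~ N(m, v)`; for `v > 0` this is
`Φ(m/√v) + e^{m + v/2} Φ(−√v − m/√v)`, and `G(m, 0) = min(1, e^m)`. -/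
noncomputable def Gfun (m v : ℝ) : ℝ :=
  if v = 0 then min 1 (Real.exp m)
  else stdPhi (m / Real.sqrt v) + Real.exp (m + v / 2) * stdPhi (-Real.sqrt v - m / Real.sqrt v)

/-- The standard normal density `φ`. -/
noncomputable def stdphi (x : ℝ) : ℝ := Real.exp (-x ^ 2 / 2) / Real.sqrt (2 * Real.pi)

theorem stdphi_eq_gaussianPDFReal (x : ℝ) : stdphi x = gaussianPDFReal 0 1 x := by
  simp [stdphi, gaussianPDFReal, div_eq_inv_mul]

theorem continuous_stdphi : Continuous stdphi := by
  unfold stdphi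
  fun_prop

theorem stdphi_pos (x : ℝ) : 0 < stdphi x := by
  unfold stdphi
  positivity

theorem integrable_stdphi : Integrable stdphi :=
  (funext stdphi_eq_gaussianPDFReal : stdphi = gaussianPDFReal 0 1) ▸ integrable_gaussianPDFReal 0 1

theorem stdPhi_eq_integral (x : ℝ) : stdPhi x = ∫ t in Iic x, stdphi t := by
  rw [stdPhi, gaussianReal_apply_eq_integral 0 one_ne_zero, ENNReal.toReal_ofReal]
  · simp only [stdphi_eq_gaussianPDFReal]
  · exact integral_nonneg fun t => gaussianPDFReal_nonneg 0 1 t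

theorem hasDerivAt_stdPhi (x : ℝ) : HasDerivAt stdPhi (stdphi x) x := by
  have h_eq : stdPhi = fun y => (∫ t in (0 : ℝ)..y, stdphi t) + stdPhi 0 := by
    funext y
    rw [stdPhi_eq_integral, stdPhi_eq_integral, ← intervalIntegral.integral_Iic_sub_Iic
      integrable_stdphi.integrableOn integrable_stdphi.integrableOn, sub_add_cancel]
  rw [h_eq]
  exact (continuous_stdphi.integral_hasStrictDerivAt 0 x).hasDerivAt.add_const _

/-- The exponential tilt by `a` exchanges the two normal densities entering `G`. -/
theorem exp_mul_stdphi (a : ℝ) {σ : ℝ} (hσ : σ ≠ 0) :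
    Real.exp a * stdphi (-σ / √2 - a / (σ * √2)) = stdphi (-σ / √2 + a / (σ * √2)) := by
  unfold stdphi
  rw [← mul_div_assoc, ← Real.exp_add]
  congr 2
  field_simp
  ring_nf
  norm_num
  ring

theorem Gfun_neg_sq_add (a : ℝ) {σ : ℝ} (hσ : 0 < σ) :
    Gfun (-σ ^ 2 + a) (2 * σ ^ 2) =
      stdPhi (-σ / √2 + a / (σ * √2)) + Real.exp a * stdPhi (-σ / √2 - a / (σ * √2)) := by
  have h_sqrt : √(2 * σ ^ 2) = σ * √2 := by
    rw [Real.sqrt_mul (by norm_num), Real.sqrt_sq hσ.le, mul_comm]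
  have h_two : √2 ^ 2 = (2 : ℝ) := Real.sq_sqrt (by norm_num)
  rw [Gfun, if_neg (by positivity), h_sqrt]
  congr 2
  · field_simp
  · congr 1
    ring
  · congr 1
    field_simp
    rw [h_two]
    ring

theorem hasDerivAt_Gfun_neg_sq_add (a : ℝ) {σ : ℝ} (hσ : 0 < σ) :
    HasDerivAt (fun σ : ℝ => Gfun (-σ ^ 2 + a) (2 * σ ^ 2))
      (-√2 * stdphi (-σ / √2 + a / (σ * √2))) σ := by
  have h_two : √2 ^ 2 = (2 : ℝ) := Real.sq_sqrt (by norm_num)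
  have h_lin : HasDerivAt (fun y : ℝ => -y / √2) (-1 / √2) σ :=
    (hasDerivAt_id σ).neg.div_const _
  have h_inv : HasDerivAt (fun y : ℝ => a / (y * √2))
      ((0 * (σ * √2) - a * (1 * √2)) / (σ * √2) ^ 2) σ :=
    (hasDerivAt_const σ a).div ((hasDerivAt_id σ).mul_const _) (by positivity)
  have h_sum := ((hasDerivAt_stdPhi _).comp σ (h_lin.add h_inv)).add
    (((hasDerivAt_stdPhi _).comp σ (h_lin.sub h_inv)).const_mul (Real.exp a))
  refine (h_sum.congr_of_eventuallyEq ?_).congr_deriv ?_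
  · filter_upwards [Ioi_mem_nhds hσ] with y hy
    exact Gfun_neg_sq_add a hy
  · simp only [Pi.add_apply, Pi.sub_apply]
    rw [← mul_assoc (Real.exp a), exp_mul_stdphi a hσ.ne', ← mul_add]
    field_simp
    rw [h_two]
    ring

/-- for every fixed `a ∈ ℝ`, the function `σ ↦ G(−σ² + a, 2σ²)` is strictly
decreasing on `(0, ∞)`, and its derivative is at most
`−√2·φ(−σ/√2 + a/(σ√2)) < 0` for every `σ > 0`. -/
theorem stmt8 (a : ℝ) :
    StrictAntiOn (fun σ : ℝ => Gfun (-σ ^ 2 + a) (2 * σ ^ 2)) (Set.Ioi 0) ∧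
      ∀ σ : ℝ, 0 < σ →
        deriv (fun σ : ℝ => Gfun (-σ ^ 2 + a) (2 * σ ^ 2)) σ ≤
            -Real.sqrt 2 * stdphi (-σ / Real.sqrt 2 + a / (σ * Real.sqrt 2)) ∧
          -Real.sqrt 2 * stdphi (-σ / Real.sqrt 2 + a / (σ * Real.sqrt 2)) < 0 := by
  have h_neg (σ : ℝ) : -√2 * stdphi (-σ / √2 + a / (σ * √2)) < 0 :=
    mul_neg_of_neg_of_pos (neg_lt_zero.2 (by positivity)) (stdphi_pos _)
  refine ⟨strictAntiOn_of_deriv_neg (convex_Ioi 0) (fun σ hσ =>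
    (hasDerivAt_Gfun_neg_sq_add a hσ).continuousAt.continuousWithinAt) fun σ hσ => ?_,
    fun σ hσ => ⟨(hasDerivAt_Gfun_neg_sq_add a hσ).deriv.le, h_neg σ⟩⟩
  rw [interior_Ioi] at hσ
  rw [(hasDerivAt_Gfun_neg_sq_add a hσ).deriv]
  exact h_neg σ
end

section
/- Fix β₂ > 0, β₁ ∈ ℝ with |β₁| ≤ β₂ and β₁ < 1, and η > 0. For every fixed μ > 0, the map v ↦ Eff(μ, v) on the interval v = σ² ∈ (0, 6) has no local minimum point and at most one local maximum point. In particular, at any interior stationary point σ with 0 < σ² < 6 (i.e. where ∂_σ Eff(μ, σ²) = 0), the second derivative ∂²_σ Eff(μ, σ²) is strictly negative. -/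
open MeasureTheory ProbabilityTheory Real Filter Set
open scoped Topology

/-- The efficiency functional `Eff(μ, σ²) = μ² σ² α₁₂(μ, σ) / (η σ² + α₁(μ))`,
written as a function of `v = σ²`. -/
noncomputable def Eff (η μ β₁ β₂ v : ℝ) : ℝ :=
  μ ^ 2 * v * alpha12 μ (Real.sqrt v) β₁ β₂ / (η * v + alpha1 μ β₁ β₂)

lemma Facc_eq_exp_min (u : ℝ) : Facc u = Real.exp (min 0 u) := by
  unfold Facc
  rw [Real.exp_monotone.map_min, Real.exp_zero]

lemma Facc_pos (u : ℝ) : 0 < Facc u := by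
  rw [Facc_eq_exp_min]; exact Real.exp_pos _

lemma Facc_le_one (u : ℝ) : Facc u ≤ 1 := min_le_left _ _

lemma norm_Facc_le_one (u : ℝ) : ‖Facc u‖ ≤ 1 := by
  rw [Real.norm_of_nonneg (Facc_pos u).le]; exact Facc_le_one u

lemma continuous_Facc : Continuous Facc := by
  unfold Facc; fun_prop

lemma abs_Facc_sub_le (x y : ℝ) : |Facc x - Facc y| ≤ |x - y| := by
  wlog h : x ≤ y generalizing x y
  · rw [abs_sub_comm, abs_sub_comm x]; exact this y x (le_of_not_ge h)
  have hm : min 0 x ≤ min 0 y := min_le_min_left 0 h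
  have hd : min 0 y - min 0 x ≤ y - x := by
    rcases min_cases 0 x with h1 | h1 <;> rcases min_cases 0 y with h2 | h2 <;> linarith
  have h1 := Real.add_one_le_exp (min 0 x - min 0 y)
  have h2 : Real.exp (min 0 x) = Real.exp (min 0 y) * Real.exp (min 0 x - min 0 y) := by
    rw [← Real.exp_add]; ring_nf
  have h3 : Real.exp (min 0 y) ≤ 1 := Real.exp_le_one_iff.2 (min_le_left _ _)
  have h4 : Real.exp (min 0 x) ≤ Real.exp (min 0 y) := Real.exp_le_exp.2 hm
  rw [abs_sub_comm, abs_sub_comm x, Facc_eq_exp_min, Facc_eq_exp_min, abs_of_nonneg (by linarith),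
    abs_of_nonneg (by linarith)]
  nlinarith [Real.exp_pos (min 0 y)]

lemma hasDerivAt_Facc {u : ℝ} (hu : u ≠ 0) :
    HasDerivAt Facc (if u < 0 then Real.exp u else 0) u := by
  rcases lt_or_gt_of_ne hu with h | h
  · rw [if_pos h]
    refine (Real.hasDerivAt_exp u).congr_of_eventuallyEq ?_
    filter_upwards [gt_mem_nhds h] with x hx
    rw [Facc_eq_exp_min, min_eq_right hx.le]
  · rw [if_neg h.not_gt]
    refine (hasDerivAt_const u (1 : ℝ)).congr_of_eventuallyEq ?_
    filter_upwards [lt_mem_nhds h] with x hx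
    rw [Facc_eq_exp_min, min_eq_left hx.le, Real.exp_zero]

/-- The density at `s` of the Gaussian law `N(-v, 2v)`. -/
noncomputable def noiseDensity (v s : ℝ) : ℝ :=
  (√(4 * π * v))⁻¹ * Real.exp (-((s + v) ^ 2 / (4 * v)))

/-- The second-stage acceptance probability `E[F(W - s)]` for `W ~ N(-v, 2v)`. -/
noncomputable def noiseAcc (v s : ℝ) : ℝ :=
  ∫ z, Facc (-v + √(2 * v) * z - s) ∂(gaussianReal 0 1)

lemma gaussNoise_sqrt {v : ℝ} (hv : 0 ≤ v) :
    gaussNoise (√v) = (gaussianReal 0 1).map (fun z => -v + √(2 * v) * z) := by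
  have h : (fun z => -v + √(2 * v) * z) = (fun x => -v + x) ∘ (fun z => √(2 * v) * z) := rfl
  rw [h, ← Measure.map_map (by fun_prop) (by fun_prop), gaussianReal_map_const_mul,
    gaussianReal_map_const_add, gaussNoise, Real.sq_sqrt hv]
  congr 1
  · simp
  · ext
    simp only [mul_one, NNReal.coe_mk]
    rw [Real.sq_sqrt (by linarith), Real.coe_toNNReal _ (by linarith)]

lemma integral_Facc_gaussNoise {v : ℝ} (hv : 0 ≤ v) (s : ℝ) :
    ∫ w, Facc (w - s) ∂(gaussNoise (√v)) = noiseAcc v s := by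
  rw [gaussNoise_sqrt hv, integral_map (by fun_prop)]
  · rfl
  · exact (continuous_Facc.comp (by fun_prop)).aestronglyMeasurable

lemma integral_Iic_sub_mul_exp (a t : ℝ) :
    ∫ z in Iic a, (z - t) * Real.exp (-(1 / 2) * (z - t) ^ 2)
      = -Real.exp (-(1 / 2) * (a - t) ^ 2) := by
  have hd : ∀ x : ℝ, HasDerivAt (fun z => -Real.exp (-(1 / 2) * (z - t) ^ 2))
      ((x - t) * Real.exp (-(1 / 2) * (x - t) ^ 2)) x := by
    intro x
    have h := (((((hasDerivAt_id x).sub_const t).pow 2).const_mul (-(1 / 2) : ℝ)).exp).neg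
    refine h.congr_deriv ?_
    simp; ring
  have hi : Integrable (fun z => (z - t) * Real.exp (-(1 / 2) * (z - t) ^ 2)) :=
    (integrable_mul_exp_neg_mul_sq (b := 1 / 2) (by norm_num)).comp_sub_right t
  have hT : Tendsto (fun z => -Real.exp (-(1 / 2) * (z - t) ^ 2)) atBot (𝓝 (-0)) := by
    refine (Real.tendsto_exp_atBot.comp ?_).neg
    refine Tendsto.const_mul_atTop_of_neg (by norm_num) ?_
    have : (fun z : ℝ => (z - t) ^ 2) = fun z => (-(z - t)) ^ 2 := by ext; ring
    rw [this]
    refine (tendsto_pow_atTop (by norm_num)).comp (tendsto_neg_atBot_atTop.comp ?_)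
    exact tendsto_atBot_add_const_right _ _ tendsto_id
  rw [integral_Iic_of_hasDerivAt_of_tendsto (hd a).continuousAt.continuousWithinAt
    (fun x _ => hd x) hi.integrableOn hT]
  simp

lemma integral_deriv_noiseAcc {v : ℝ} (hv : 0 < v) (s : ℝ) :
    ∫ z, (if -v + √(2 * v) * z - s < 0 then Real.exp (-v + √(2 * v) * z - s) else 0)
      * (-1 + z / √(2 * v)) ∂(gaussianReal 0 1) = -noiseDensity v s := by
  have ht : 0 < √(2 * v) := Real.sqrt_pos.2 (by linarith)
  have ht2 : √(2 * v) ^ 2 = 2 * v := Real.sq_sqrt (by linarith)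
  have hden : √(4 * π * v) = √(2 * v) * √(2 * π) := by
    rw [← Real.sqrt_mul (by linarith)]; congr 1; ring
  have hpi : 0 < √(2 * π) := Real.sqrt_pos.2 (by positivity)
  set t := √(2 * v) with htdef
  rw [integral_gaussianReal_eq_integral_smul one_ne_zero]
  have hfun : (fun z => gaussianPDFReal 0 1 z •
      ((if -v + t * z - s < 0 then Real.exp (-v + t * z - s) else 0) * (-1 + z / t)))
      = (Iio ((s + v) / t)).indicator (fun z => (Real.exp (-s) / (t * √(2 * π))) *
        ((z - t) * Real.exp (-(1 / 2) * (z - t) ^ 2))) := by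
    ext z
    have hiff : -v + t * z - s < 0 ↔ z ∈ Iio ((s + v) / t) := by
      rw [mem_Iio, lt_div_iff₀ ht]; constructor <;> intro h <;> linarith
    by_cases hz : -v + t * z - s < 0
    · rw [if_pos hz, indicator_of_mem (hiff.1 hz)]
      have he : Real.exp (-s) * Real.exp (-(1 / 2) * (z - t) ^ 2)
          = Real.exp (-(z ^ 2 / 2)) * Real.exp (-v + t * z - s) := by
        rw [← Real.exp_add, ← Real.exp_add]; congr 1; linear_combination (-1 / 2) * ht2
      have hp : gaussianPDFReal 0 1 z = (√(2 * π))⁻¹ * Real.exp (-(z ^ 2 / 2)) := by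
        simp [gaussianPDFReal, neg_div]
      have h1 : (-1 + z / t) = (z - t) / t := by field_simp; ring
      rw [smul_eq_mul, hp, h1]
      calc _ = (√(2 * π))⁻¹ * ((z - t) / t) *
            (Real.exp (-(z ^ 2 / 2)) * Real.exp (-v + t * z - s)) := by ring
        _ = _ := by rw [← he]; field_simp
    · rw [if_neg hz, indicator_of_notMem (fun h => hz (hiff.2 h))]; simp
  rw [hfun, integral_indicator measurableSet_Iio, ← integral_Iic_eq_integral_Iio,
    integral_const_mul, integral_Iic_sub_mul_exp, noiseDensity, hden]
  have he : Real.exp (-((s + v) ^ 2 / (4 * v)))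
      = Real.exp (-s) * Real.exp (-(1 / 2) * ((s + v) / t - t) ^ 2) := by
    rw [← Real.exp_add]; congr 1
    have h4 : 4 * v = 2 * t ^ 2 := by linarith
    have hvt : v = t ^ 2 / 2 := by linarith
    rw [h4, hvt]
    field_simp
    ring
  rw [he]
  field_simp

lemma hasDerivAt_noiseAcc {v : ℝ} (hv : 0 < v) (s : ℝ) :
    HasDerivAt (fun v => noiseAcc v s) (-noiseDensity v s) v := by
  rw [← integral_deriv_noiseAcc hv s]
  have ht : 0 < √(2 * v) := Real.sqrt_pos.2 (by linarith)
  have hsv : 0 < √v := Real.sqrt_pos.2 hv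
  refine (hasDerivAt_integral_of_dominated_loc_of_lip (s := Ioi (v / 2))
    (bound := fun z => 1 + |z| / √v)
    (F := fun v z => Facc (-v + √(2 * v) * z - s)) (Ioi_mem_nhds (by linarith)) ?_ ?_ ?_ ?_ ?_ ?_).2
  · exact .of_forall fun x => (continuous_Facc.comp (by fun_prop)).aestronglyMeasurable
  · exact .of_bound (continuous_Facc.comp (by fun_prop)).aestronglyMeasurable 1
      (.of_forall fun z => norm_Facc_le_one _)
  · refine Measurable.aestronglyMeasurable ?_
    refine Measurable.mul (Measurable.ite ?_ (by fun_prop) (by fun_prop)) (by fun_prop)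
    exact measurableSet_lt (by fun_prop) (by fun_prop)
  · refine .of_forall fun z => LipschitzOnWith.of_dist_le_mul fun x hx y hy => ?_
    rw [mem_Ioi] at hx hy
    rw [Real.dist_eq, Real.dist_eq, Real.coe_nnabs,
      abs_of_nonneg (by positivity : (0 : ℝ) ≤ 1 + |z| / √v)]
    refine (abs_Facc_sub_le _ _).trans ?_
    have hroot : ∀ w, v / 2 < w → √v ≤ √(2 * w) := fun w hw => Real.sqrt_le_sqrt (by linarith)
    have hx' := hroot x hx
    have hy' := hroot y hy
    have hmul : (√(2 * x) - √(2 * y)) * (√(2 * x) + √(2 * y)) = 2 * (x - y) := by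
      have h1 := Real.sq_sqrt (show 0 ≤ 2 * x by linarith)
      have h2 := Real.sq_sqrt (show 0 ≤ 2 * y by linarith)
      linear_combination h1 - h2
    have hsq : |√(2 * x) - √(2 * y)| ≤ |x - y| / √v := by
      rw [le_div_iff₀ hsv]
      have := congrArg abs hmul
      rw [abs_mul, abs_mul, abs_of_pos (by linarith : 0 < √(2 * x) + √(2 * y)), abs_two] at this
      nlinarith [abs_nonneg (√(2 * x) - √(2 * y))]
    calc |-x + √(2 * x) * z - s - (-y + √(2 * y) * z - s)|
        = |(-(x - y)) + (√(2 * x) - √(2 * y)) * z| := by congr 1; ring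
      _ ≤ |x - y| + |√(2 * x) - √(2 * y)| * |z| := by
        refine (abs_add_le _ _).trans ?_
        rw [abs_neg, abs_mul]
      _ ≤ |x - y| + |x - y| / √v * |z| := by gcongr
      _ = (1 + |z| / √v) * |x - y| := by ring
  · have h : Integrable (id : ℝ → ℝ) (gaussianReal 0 1) :=
      (memLp_id_gaussianReal (μ := 0) (v := 1) 1).integrable (by simp)
    exact (integrable_const _).add (h.abs.div_const _)
  · have := nullSingletonClass_gaussianReal (μ := 0) (v := 1) one_ne_zero
    filter_upwards [measure_eq_zero_iff_ae_notMem.1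
      (measure_singleton (μ := gaussianReal 0 1) ((s + v) / √(2 * v)))] with z hz
    have hne : -v + √(2 * v) * z - s ≠ 0 := by
      intro h
      apply hz
      rw [mem_singleton_iff, eq_div_iff ht.ne']
      linarith
    have hin : HasDerivAt (fun v => -v + √(2 * v) * z - s) (-1 + z / √(2 * v)) v := by
      have hs := ((hasDerivAt_id v).const_mul 2).sqrt (by simp; linarith)
      refine (((hasDerivAt_id v).neg.add (hs.mul_const z)).sub_const s).congr_deriv ?_
      simp only [id]
      field_simp
    exact HasDerivAt.comp (h₂ := Facc) v (hasDerivAt_Facc hne) hin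

lemma noiseDensity_pos {v : ℝ} (hv : 0 < v) (s : ℝ) : 0 < noiseDensity v s := by
  have : 0 < √(4 * π * v) := Real.sqrt_pos.2 (by positivity)
  unfold noiseDensity; positivity

lemma noiseDensity_le {v w : ℝ} (hw : 0 < w) (hwv : w ≤ v) (s : ℝ) :
    noiseDensity v s ≤ (√(4 * π * w))⁻¹ := by
  have hv : 0 < v := hw.trans_le hwv
  have h0 : 0 < √(4 * π * w) := Real.sqrt_pos.2 (by positivity)
  have h1 : √(4 * π * w) ≤ √(4 * π * v) := Real.sqrt_le_sqrt (by gcongr)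
  have h2 : Real.exp (-((s + v) ^ 2 / (4 * v))) ≤ 1 :=
    Real.exp_le_one_iff.2 (neg_nonpos.2 (by positivity))
  calc noiseDensity v s ≤ (√(4 * π * v))⁻¹ * 1 := by
        unfold noiseDensity; gcongr
    _ ≤ _ := by rw [mul_one]; gcongr

@[fun_prop]
lemma continuous_noiseDensity (v : ℝ) : Continuous (noiseDensity v) := by
  unfold noiseDensity; fun_prop

lemma hasDerivAt_noiseDensity {v : ℝ} (hv : 0 < v) (s : ℝ) :
    HasDerivAt (fun v => noiseDensity v s)
      (noiseDensity v s * (s ^ 2 / (4 * v ^ 2) - 1 / (2 * v) - 1 / 4)) v := by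
  have hq : 0 < √(4 * π * v) := Real.sqrt_pos.2 (by positivity)
  have hq2 : √(4 * π * v) ^ 2 = 4 * π * v := Real.sq_sqrt (by positivity)
  have h1 := ((((hasDerivAt_id v).const_mul (4 * π)).sqrt
    (by simp [hv.ne', Real.pi_ne_zero])).inv (by simpa using hq.ne'))
  have h2 := ((((hasDerivAt_id v).const_add s).pow 2).div ((hasDerivAt_id v).const_mul 4)
    (by simpa using hv.ne')).neg.exp
  refine (h1.mul h2).congr_deriv ?_
  simp only [id, noiseDensity, Pi.inv_apply, Pi.div_apply, Pi.pow_apply, Pi.neg_apply]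
  rw [hq2]
  field_simp
  ring

lemma abs_deriv_noiseDensity_le {v w : ℝ} (hw : 0 < w) (hwv : w ≤ v) (s : ℝ) :
    |noiseDensity v s * (s ^ 2 / (4 * v ^ 2) - 1 / (2 * v) - 1 / 4)|
      ≤ (√(4 * π * w))⁻¹ * (5 / (2 * w) + 3 / 4) := by
  have hv : 0 < v := hw.trans_le hwv
  have h0 : 0 < √(4 * π * w) := Real.sqrt_pos.2 (by positivity)
  have h1 : √(4 * π * w) ≤ √(4 * π * v) := Real.sqrt_le_sqrt (by gcongr)
  set y := (s + v) ^ 2 / (4 * v) with hy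
  have hy0 : 0 ≤ y := by positivity
  have he1 : Real.exp (-y) ≤ 1 := Real.exp_le_one_iff.2 (neg_nonpos.2 hy0)
  have hye : Real.exp (-y) * y ≤ 1 := by
    have := Real.add_one_le_exp y
    calc Real.exp (-y) * y ≤ Real.exp (-y) * Real.exp y := by gcongr; linarith
      _ = 1 := by rw [← Real.exp_add]; simp
  have hs : s ^ 2 / (4 * v ^ 2) ≤ 2 * y / v + 1 / 2 := by
    rw [hy, div_le_iff₀ (by positivity)]
    have : (2 * ((s + v) ^ 2 / (4 * v)) / v + 1 / 2) * (4 * v ^ 2)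
        = 2 * (s + v) ^ 2 + 2 * v ^ 2 := by field_simp; ring
    rw [this]
    nlinarith [sq_nonneg (s + 2 * v)]
  have habs : |s ^ 2 / (4 * v ^ 2) - 1 / (2 * v) - 1 / 4|
      ≤ 2 * y / v + 1 / 2 + 1 / (2 * v) + 1 / 4 := by
    have : 0 ≤ s ^ 2 / (4 * v ^ 2) := by positivity
    have : 0 ≤ 1 / (2 * v) := by positivity
    have : 0 ≤ 2 * y / v := by positivity
    rw [abs_le]; constructor <;> linarith
  rw [abs_mul, abs_of_pos (noiseDensity_pos hv s)]
  calc noiseDensity v s * |s ^ 2 / (4 * v ^ 2) - 1 / (2 * v) - 1 / 4|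
      ≤ noiseDensity v s * (2 * y / v + 1 / 2 + 1 / (2 * v) + 1 / 4) := by
        have := (noiseDensity_pos hv s).le
        gcongr
    _ = (√(4 * π * v))⁻¹ * (Real.exp (-y) * y * (2 / v)
          + Real.exp (-y) * (1 / (2 * v) + 3 / 4)) := by
        rw [noiseDensity, ← hy]; ring
    _ ≤ (√(4 * π * w))⁻¹ * (1 * (2 / w) + 1 * (1 / (2 * w) + 3 / 4)) := by
        gcongr
    _ = _ := by field_simp; ring

lemma measurable_noiseAcc (v : ℝ) : Measurable (noiseAcc v) := by
  have h : StronglyMeasurable (fun p : ℝ × ℝ => Facc (-v + √(2 * v) * p.2 - p.1)) :=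
    (continuous_Facc.comp (by fun_prop)).stronglyMeasurable
  exact h.integral_prod_right'.measurable

lemma norm_noiseAcc_le_one (v s : ℝ) : ‖noiseAcc v s‖ ≤ 1 := by
  refine (norm_integral_le_of_norm_le_const (C := 1) (.of_forall fun z =>
    norm_Facc_le_one _)).trans ?_
  simp

section Weighted

variable {Ω : Type*} [MeasurableSpace Ω] {ν : Measure Ω} [IsProbabilityMeasure ν] {f S : Ω → ℝ}

lemma hasDerivAt_integral_noiseAcc (hf : Measurable f) (hf1 : ∀ ω, ‖f ω‖ ≤ 1) (hS : Measurable S)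
    {v : ℝ} (hv : 0 < v) :
    HasDerivAt (fun v => ∫ ω, f ω * noiseAcc v (S ω) ∂ν)
      (-∫ ω, f ω * noiseDensity v (S ω) ∂ν) v := by
  have hm : ∀ x, AEStronglyMeasurable (fun ω => f ω * noiseAcc x (S ω)) ν := fun x =>
    (hf.mul ((measurable_noiseAcc x).comp hS)).aestronglyMeasurable
  rw [← integral_neg]
  refine (hasDerivAt_integral_of_dominated_loc_of_deriv_le (s := Ioi (v / 2))
    (F := fun v ω => f ω * noiseAcc v (S ω)) (F' := fun v ω => -(f ω * noiseDensity v (S ω)))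
    (bound := fun _ => (√(4 * π * (v / 2)))⁻¹)
    (Ioi_mem_nhds (by linarith)) (.of_forall hm) ?_ ?_ ?_ (integrable_const _) ?_).2
  · refine .of_bound (hm v) 1 (.of_forall fun ω => ?_)
    rw [norm_mul]
    exact mul_le_one₀ (hf1 ω) (norm_nonneg _) (norm_noiseAcc_le_one _ _)
  · exact (hf.mul ((continuous_noiseDensity v).measurable.comp hS)).neg.aestronglyMeasurable
  · refine .of_forall fun ω x hx => ?_
    rw [mem_Ioi] at hx
    rw [norm_neg, norm_mul, Real.norm_of_nonneg (noiseDensity_pos (by linarith) _).le]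
    calc ‖f ω‖ * noiseDensity x (S ω) ≤ 1 * noiseDensity x (S ω) := by
          have := (noiseDensity_pos (show 0 < x by linarith) (S ω)).le
          gcongr; exact hf1 ω
      _ ≤ _ := by rw [one_mul]; exact noiseDensity_le (by linarith) hx.le _
  · refine .of_forall fun ω x hx => ?_
    rw [mem_Ioi] at hx
    exact ((hasDerivAt_noiseAcc (show 0 < x by linarith) (S ω)).const_mul (f ω)).congr_deriv
      (by ring)

lemma integrable_mul_noiseDensity (hf : Measurable f) (hf1 : ∀ ω, ‖f ω‖ ≤ 1) (hS : Measurable S)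
    {v : ℝ} (hv : 0 < v) : Integrable (fun ω => f ω * noiseDensity v (S ω)) ν := by
  refine .of_bound (hf.mul ((continuous_noiseDensity v).measurable.comp hS)).aestronglyMeasurable
    (√(4 * π * v))⁻¹ (.of_forall fun ω => ?_)
  rw [norm_mul, Real.norm_of_nonneg (noiseDensity_pos hv _).le]
  exact (mul_le_of_le_one_left (noiseDensity_pos hv _).le (hf1 ω)).trans
    (noiseDensity_le hv le_rfl _)

lemma hasDerivAt_integral_noiseDensity (hf : Measurable f) (hf0 : ∀ ω, 0 ≤ f ω)
    (hf1 : ∀ ω, ‖f ω‖ ≤ 1) (hS : Measurable S) {v : ℝ} (hv : 0 < v) :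
    ∃ D', HasDerivAt (fun v => ∫ ω, f ω * noiseDensity v (S ω) ∂ν) D' v ∧
      -(1 / (2 * v) + 1 / 4) * ∫ ω, f ω * noiseDensity v (S ω) ∂ν ≤ D' := by
  have hm : ∀ x, AEStronglyMeasurable (fun ω => f ω * noiseDensity x (S ω)) ν := fun x =>
    (hf.mul ((continuous_noiseDensity x).measurable.comp hS)).aestronglyMeasurable
  obtain ⟨hi, hd⟩ := hasDerivAt_integral_of_dominated_loc_of_deriv_le (s := Ioi (v / 2)) (μ := ν)
    (F := fun v ω => f ω * noiseDensity v (S ω))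
    (F' := fun v ω => f ω * (noiseDensity v (S ω) *
      ((S ω) ^ 2 / (4 * v ^ 2) - 1 / (2 * v) - 1 / 4)))
    (bound := fun _ => (√(4 * π * (v / 2)))⁻¹ * (5 / (2 * (v / 2)) + 3 / 4))
    (Ioi_mem_nhds (by linarith)) (.of_forall hm) (integrable_mul_noiseDensity hf hf1 hS hv)
    (by
      have := (continuous_noiseDensity v).measurable.comp hS
      exact (hf.mul (this.mul (by fun_prop))).aestronglyMeasurable)
    (by
      refine .of_forall fun ω x hx => ?_
      rw [norm_mul]
      exact (mul_le_of_le_one_left (norm_nonneg _) (hf1 ω)).trans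
        (abs_deriv_noiseDensity_le (by linarith) (le_of_lt hx) _))
    (integrable_const _)
    (.of_forall fun ω x hx =>
      (hasDerivAt_noiseDensity (lt_trans (by linarith) (mem_Ioi.1 hx)) (S ω)).const_mul (f ω))
  refine ⟨_, hd, ?_⟩
  rw [← integral_const_mul]
  refine integral_mono ((integrable_mul_noiseDensity hf hf1 hS hv).const_mul _) hi fun ω => ?_
  have h1 : 0 ≤ f ω * noiseDensity v (S ω) :=
    mul_nonneg (hf0 ω) (noiseDensity_pos hv _).le
  have h2 : 0 ≤ (S ω) ^ 2 / (4 * v ^ 2) := by positivity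
  have := mul_nonneg h1 h2
  simp only
  linarith

end Weighted

lemma integral_pos_of_forall_pos {Ω : Type*} [MeasurableSpace Ω] {ν : Measure Ω} [NeZero ν]
    {f : Ω → ℝ} (hi : Integrable f ν) (hf : ∀ ω, 0 < f ω) : 0 < ∫ ω, f ω ∂ν := by
  rw [integral_pos_iff_support_of_nonneg (fun ω => (hf ω).le) hi,
    show Function.support f = univ from eq_univ_of_forall fun ω => (hf ω).ne']
  exact Measure.measure_univ_pos.2 (NeZero.ne ν)

instance isProbabilityMeasure_QSmeas (μ β₁ β₂ : ℝ) : IsProbabilityMeasure (QSmeas μ β₁ β₂) :=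
  Measure.isProbabilityMeasure_map (by fun_prop)

instance isProbabilityMeasure_gaussNoise (σ : ℝ) : IsProbabilityMeasure (gaussNoise σ) := by
  unfold gaussNoise; infer_instance

lemma alpha1_pos (μ β₁ β₂ : ℝ) : 0 < alpha1 μ β₁ β₂ := by
  refine integral_pos_of_forall_pos ?_ fun p => Facc_pos _
  exact .of_bound (continuous_Facc.comp (by fun_prop)).aestronglyMeasurable 1
    (.of_forall fun p => norm_Facc_le_one _)

lemma alpha12_sqrt (μ β₁ β₂ : ℝ) {v : ℝ} (hv : 0 ≤ v) :
    alpha12 μ (√v) β₁ β₂ = ∫ p, Facc (p.1 + p.2) * noiseAcc v p.2 ∂(QSmeas μ β₁ β₂) := by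
  rw [alpha12, integral_prod]
  · simp only [integral_const_mul, integral_Facc_gaussNoise hv]
  · have hc : Continuous fun p : (ℝ × ℝ) × ℝ => Facc (p.1.1 + p.1.2) * Facc (p.2 - p.1.2) :=
      (continuous_Facc.comp (by fun_prop)).mul (continuous_Facc.comp (by fun_prop))
    refine .of_bound hc.aestronglyMeasurable 1 (.of_forall fun p => ?_)
    rw [norm_mul]
    exact mul_le_one₀ (norm_Facc_le_one _) (norm_nonneg _) (norm_Facc_le_one _)

/-- On `(0, 6)` the derivative of `Eff` has the sign of a function with negative derivative. -/
lemma exists_hasDerivAt_Eff (β₁ β₂ : ℝ) {η μ : ℝ} (hη : 0 < η) :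
    ∃ N : ℝ → ℝ,
      (∀ v, 0 < v → HasDerivAt (Eff η μ β₁ β₂)
        (μ ^ 2 / (η * v + alpha1 μ β₁ β₂) ^ 2 * N v) v) ∧
      ∀ v, 0 < v → v < 6 → ∃ N' < 0, HasDerivAt N N' v := by
  set a := alpha1 μ β₁ β₂ with ha
  have ha0 : 0 < a := alpha1_pos μ β₁ β₂
  let f : ℝ × ℝ → ℝ := fun p => Facc (p.1 + p.2)
  have hf : Measurable f := (continuous_Facc.comp (by fun_prop)).measurable
  have hf1 : ∀ p, ‖f p‖ ≤ 1 := fun p => norm_Facc_le_one _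
  let A : ℝ → ℝ := fun v => ∫ p, f p * noiseAcc v p.2 ∂(QSmeas μ β₁ β₂)
  let D : ℝ → ℝ := fun v => ∫ p, f p * noiseDensity v p.2 ∂(QSmeas μ β₁ β₂)
  have hA : ∀ v, 0 < v → HasDerivAt A (-D v) v := fun v hv =>
    hasDerivAt_integral_noiseAcc hf hf1 measurable_snd hv
  refine ⟨fun v => a * A v - v * (η * v + a) * D v, fun v hv => ?_, fun v hv hv6 => ?_⟩
  · have hden : 0 < η * v + a := by positivity
    have h : HasDerivAt (fun v => μ ^ 2 * v * A v / (η * v + a))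
        (μ ^ 2 / (η * v + a) ^ 2 * (a * A v - v * (η * v + a) * D v)) v := by
      have h1 := (((hasDerivAt_id v).const_mul (μ ^ 2)).mul (hA v hv)).div
        (((hasDerivAt_id v).const_mul η).add_const a) hden.ne'
      refine h1.congr_deriv ?_
      simp only [id, Pi.mul_apply]
      field_simp
      ring
    refine h.congr_of_eventuallyEq ?_
    filter_upwards [lt_mem_nhds hv] with x hx
    simp only [Eff, alpha12_sqrt μ β₁ β₂ hx.le, A, f, ha]
  · obtain ⟨D', hD, hD'⟩ := hasDerivAt_integral_noiseDensity (ν := QSmeas μ β₁ β₂) hf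
      (fun p => (Facc_pos _).le) hf1 measurable_snd hv
    have hDpos : 0 < D v := integral_pos_of_forall_pos
      (integrable_mul_noiseDensity hf hf1 measurable_snd hv)
      fun p => mul_pos (Facc_pos _) (noiseDensity_pos hv _)
    refine ⟨_, ?_, ((hA v hv).const_mul a).sub
      (((hasDerivAt_id v).mul (((hasDerivAt_id v).const_mul η).add_const a)).mul hD)⟩
    change a * -D v - ((1 * (η * v + a) + v * (η * 1)) * D v + v * (η * v + a) * D') < 0
    have hd : v * (η * v + a) * (-(1 / (2 * v) + 1 / 4) * D v) ≤ v * (η * v + a) * D' :=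
      mul_le_mul_of_nonneg_left hD' (by positivity)
    have he : v * (η * v + a) * (-(1 / (2 * v) + 1 / 4) * D v)
        = -((η * v + a) * (1 / 2 + v / 4) * D v) := by field_simp
    have hneg : 0 < D v * (η * v + a) * (3 / 2 - v / 4) :=
      mul_pos (by positivity) (by linarith)
    linarith

/-- for fixed `β₂ > 0`, `|β₁| ≤ β₂`, `β₁ < 1`, `η > 0` and every fixed
`μ > 0`, the map `v ↦ Eff(μ, v)` on `v = σ² ∈ (0, 6)` has no local minimum point and at
most one local maximum point; in particular at any interior stationary point `σ` with
`0 < σ² < 6` (i.e. where `∂_σ Eff(μ, σ²) = 0`) the second derivative `∂²_σ Eff(μ, σ²)`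
is strictly negative. -/
theorem stmt15 (β₁ β₂ η : ℝ) (hβ₂ : 0 < β₂) (hβ : |β₁| ≤ β₂) (hβ₁ : β₁ < 1) (hη : 0 < η)
    (μ : ℝ) (hμ : 0 < μ) :
    (∀ v ∈ Set.Ioo (0 : ℝ) 6,
        ¬ IsLocalMinOn (fun v : ℝ => Eff η μ β₁ β₂ v) (Set.Ioo (0 : ℝ) 6) v) ∧
      (∀ v₁ ∈ Set.Ioo (0 : ℝ) 6, ∀ v₂ ∈ Set.Ioo (0 : ℝ) 6,
        IsLocalMaxOn (fun v : ℝ => Eff η μ β₁ β₂ v) (Set.Ioo (0 : ℝ) 6) v₁ →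
        IsLocalMaxOn (fun v : ℝ => Eff η μ β₁ β₂ v) (Set.Ioo (0 : ℝ) 6) v₂ → v₁ = v₂) ∧
      ∀ σ : ℝ, 0 < σ → σ ^ 2 < 6 →
        deriv (fun t : ℝ => Eff η μ β₁ β₂ (t ^ 2)) σ = 0 →
        deriv (deriv (fun t : ℝ => Eff η μ β₁ β₂ (t ^ 2))) σ < 0 := by
  obtain ⟨N, hE, hN⟩ := exists_hasDerivAt_Eff (μ := μ) β₁ β₂ hη
  set a := alpha1 μ β₁ β₂
  have ha0 : 0 < a := alpha1_pos μ β₁ β₂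
  have hK : ∀ v, 0 < v → 0 < μ ^ 2 / (η * v + a) ^ 2 := fun v hv => by positivity
  have hanti : StrictAntiOn N (Ioo 0 6) := by
    refine strictAntiOn_of_deriv_neg (convex_Ioo 0 6) (fun v hv => ?_) fun v hv => ?_
    · obtain ⟨_, -, h⟩ := hN v hv.1 hv.2
      exact h.continuousAt.continuousWithinAt
    · rw [interior_Ioo] at hv
      obtain ⟨N', h0, h⟩ := hN v hv.1 hv.2
      rwa [h.deriv]
  have hzero : ∀ v ∈ Ioo (0 : ℝ) 6, IsLocalExtr (Eff η μ β₁ β₂) v → N v = 0 := fun v hv h =>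
    (mul_eq_zero.1 (h.hasDerivAt_eq_zero (hE v hv.1))).resolve_left (hK v hv.1).ne'
  refine ⟨fun v hv hmin => ?_, fun v₁ h₁ v₂ h₂ hm₁ hm₂ => ?_, fun σ hσ hσ6 hd => ?_⟩
  · have hmin' : IsLocalMin (Eff η μ β₁ β₂) v := hmin.isLocalMin (Ioo_mem_nhds hv.1 hv.2)
    have h0 := hzero v hv (Or.inl hmin')
    have hanti' : StrictAntiOn (Eff η μ β₁ β₂) (Ico v 6) := by
      refine strictAntiOn_of_deriv_neg (convex_Ico v 6) (fun x hx => ?_) fun x hx => ?_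
      · exact (hE x (hv.1.trans_le hx.1)).continuousAt.continuousWithinAt
      · rw [interior_Ico] at hx
        have hx0 : 0 < x := hv.1.trans hx.1
        rw [(hE x hx0).deriv]
        have := hanti hv ⟨hx0, hx.2⟩ hx.1
        exact mul_neg_of_pos_of_neg (hK x hx0) (by linarith)
    obtain ⟨x, hx, hxv⟩ := ((hmin'.filter_mono nhdsWithin_le_nhds).and
      (Ioo_mem_nhdsGT hv.2)).exists
    exact absurd hx (not_le.2 (hanti' ⟨le_rfl, hv.2⟩ ⟨hxv.1.le, hxv.2⟩ hxv.1))
  · have e₁ := hzero v₁ h₁ (Or.inr (hm₁.isLocalMax (Ioo_mem_nhds h₁.1 h₁.2)))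
    have e₂ := hzero v₂ h₂ (Or.inr (hm₂.isLocalMax (Ioo_mem_nhds h₂.1 h₂.2)))
    exact hanti.injOn h₁ h₂ (e₁.trans e₂.symm)
  · have hderiv : ∀ t, 0 < t → HasDerivAt (fun t : ℝ => Eff η μ β₁ β₂ (t ^ 2))
        (μ ^ 2 / (η * t ^ 2 + a) ^ 2 * N (t ^ 2) * (2 * t)) t := fun t ht => by
      have hsq : HasDerivAt (fun t : ℝ => t ^ 2) (2 * t) t := by simpa using hasDerivAt_pow 2 t
      exact (hE (t ^ 2) (by positivity)).comp t hsq
    have hσ2 : 0 < σ ^ 2 := by positivity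
    have hN0 : N (σ ^ 2) = 0 := by
      rw [(hderiv σ hσ).deriv] at hd
      have := hK _ hσ2
      simpa [hσ.ne', this.ne'] using hd
    obtain ⟨N', hneg, hN'⟩ := hN (σ ^ 2) hσ2 hσ6
    have hsq : HasDerivAt (fun t : ℝ => t ^ 2) (2 * σ) σ := by simpa using hasDerivAt_pow 2 σ
    have hc : DifferentiableAt ℝ (fun t : ℝ => μ ^ 2 / (η * t ^ 2 + a) ^ 2 * (2 * t)) σ := by
      have : (η * σ ^ 2 + a) ^ 2 ≠ 0 := by positivity
      fun_prop (disch := assumption)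
    have hsnd := hc.hasDerivAt.mul (HasDerivAt.comp (h := fun t : ℝ => t ^ 2) σ hN' hsq)
    have heq : deriv (fun t : ℝ => Eff η μ β₁ β₂ (t ^ 2)) =ᶠ[𝓝 σ]
        (fun t : ℝ => μ ^ 2 / (η * t ^ 2 + a) ^ 2 * (2 * t)) * (N ∘ fun t : ℝ => t ^ 2) := by
      filter_upwards [lt_mem_nhds hσ] with t ht
      rw [(hderiv t ht).deriv]
      simp only [Pi.mul_apply, Function.comp]
      ring
    rw [heq.deriv_eq, hsnd.deriv]
    simp only [Function.comp, hN0, mul_zero, zero_add]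
    have := hK _ hσ2
    have h2 : N' * (2 * σ) < 0 := mul_neg_of_neg_of_pos hneg (by positivity)
    exact mul_neg_of_pos_of_neg (by positivity) h2
end
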